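/- Fix γ ∈ (0,1]. For every t ∈ ℝ, T > 0 and every complex z with |z| ≤ 1, the generating function q_γ^{(σ)}(z) = Π_{i∈ℤ} (1 + (z-1)·γ·p_i(t,t+T)) of the number of arrivals in (t,t+T] of the PSRA process with independent deletions converges, as σ → ∞, to exp(γλT(z-1)), the generating function of the Poisson distribution with intensity γλT. -/

import Mathlib

open MeasureTheory Filter

/-- Translation is continuous in `L¹` for nonnegative continuous integrable functions. -/
lemma tendsto_integral_abs_translate_sub {f : ℝ → ℝ} (hc : Continuous f) (h0 : ∀ x, 0 ≤ f x)
    (hi : Integrable f) :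
    Tendsto (fun s : ℝ => ∫ x, |f (x + s) - f x|) (nhds 0) (nhds 0) := by
  have key : ∀ s : ℝ, ∫ x, |f (x + s) - f x| = 2 * ∫ x, max (f x - f (x + s)) 0 := by
    intro s
    have his : Integrable (fun x => f (x + s)) := hi.comp_add_right s
    have hd : Integrable (fun x => f (x + s) - f x) := his.sub hi
    have hm : Integrable (fun x => max (f x - f (x + s)) 0) := (hi.sub his).pos_part
    have h : ∀ x, |f (x + s) - f x| = (f (x + s) - f x) + 2 * max (f x - f (x + s)) 0 := by
      intro x
      rcases le_total (f x) (f (x + s)) with h | h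
      · rw [abs_of_nonneg (by linarith), max_eq_right (by linarith)]; ring
      · rw [abs_of_nonpos (by linarith), max_eq_left (by linarith)]; ring
    simp_rw [h]
    rw [integral_add hd (hm.const_mul 2), integral_sub his hi,
      integral_add_right_eq_self f s, integral_const_mul]
    ring
  simp_rw [key]
  have hlim : Tendsto (fun s : ℝ => ∫ x, max (f x - f (x + s)) 0) (nhds 0)
      (nhds (∫ _ : ℝ, (0 : ℝ))) := by
    refine tendsto_integral_filter_of_dominated_convergence f
      (Eventually.of_forall fun s => ?_) (Eventually.of_forall fun s => ?_) hi ?_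
    · exact Continuous.aestronglyMeasurable (by fun_prop)
    · refine Eventually.of_forall fun x => ?_
      rw [Real.norm_of_nonneg (le_max_right _ _)]
      exact max_le (by linarith [h0 (x + s)]) (h0 x)
    · refine Eventually.of_forall fun x => ?_
      have : Continuous fun s => max (f x - f (x + s)) 0 := by fun_prop
      simpa using this.tendsto 0
  simpa using hlim.const_mul 2

/-- The integrals of `f` over the windows `((a - i) / ω, (b - i) / ω]`, `i ∈ ℤ`, add up to the
integral of `f` against the number of windows covering each point. -/
lemma hasSum_integral_windows {f : ℝ → ℝ} (h0 : ∀ x, 0 ≤ f x) (hi : Integrable f)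
    {a b ω : ℝ} (hab : a ≤ b) (hω : 0 < ω) :
    HasSum (fun i : ℤ => ∫ u in (a - i) / ω..(b - i) / ω, f u)
      (∫ u, ((b - a) - (Int.fract (b - ω * u) - Int.fract (a - ω * u))) * f u) := by
  have hmem : ∀ (i : ℤ) (u : ℝ), u ∈ Set.Ioc ((a - i) / ω) ((b - i) / ω) ↔
      i ∈ Finset.Ioc ⌊a - ω * u⌋ ⌊b - ω * u⌋ := by
    intro i u
    rw [Set.mem_Ioc, Finset.mem_Ioc, div_lt_iff₀ hω, le_div_iff₀ hω, Int.floor_lt, Int.le_floor]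
    constructor <;> rintro ⟨h1, h2⟩ <;> constructor <;> linarith
  have hind : ∀ i : ℤ, ∫ u in (a - i) / ω..(b - i) / ω, f u =
      ∫ u, (Set.Ioc ((a - i) / ω) ((b - i) / ω)).indicator f u := by
    intro i
    rw [intervalIntegral.integral_of_le (by gcongr), integral_indicator measurableSet_Ioc]
  have hpt : ∀ u, HasSum (fun i : ℤ => (Set.Ioc ((a - i) / ω) ((b - i) / ω)).indicator f u)
      (((b - a) - (Int.fract (b - ω * u) - Int.fract (a - ω * u))) * f u) := by
    intro u
    have hs := hasSum_sum_of_ne_finset_zero (L := SummationFilter.unconditional ℤ)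
      (f := fun i : ℤ => (Set.Ioc ((a - i) / ω) ((b - i) / ω)).indicator f u)
      (s := Finset.Ioc ⌊a - ω * u⌋ ⌊b - ω * u⌋)
      (fun i hin => Set.indicator_of_notMem (fun h => hin ((hmem i u).1 h)) f)
    rw [Finset.sum_congr rfl
      (fun i hin => Set.indicator_of_mem ((hmem i u).2 hin) f)] at hs
    rw [Finset.sum_const, Int.card_Ioc, nsmul_eq_mul] at hs
    convert hs using 2
    have hle : ⌊a - ω * u⌋ ≤ ⌊b - ω * u⌋ := Int.floor_le_floor (by linarith)
    have hcast : (((⌊b - ω * u⌋ - ⌊a - ω * u⌋).toNat : ℤ) : ℝ) =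
        ((⌊b - ω * u⌋ - ⌊a - ω * u⌋ : ℤ) : ℝ) := by
      rw [Int.toNat_of_nonneg (by linarith)]
    rw [← Int.cast_natCast (R := ℝ), hcast]
    push_cast
    simp only [Int.fract]
    ring
  simp_rw [hind]
  refine hasSum_integral_of_dominated_convergence
    (fun i u => (Set.Ioc ((a - i) / ω) ((b - i) / ω)).indicator f u)
    (fun i => (hi.indicator measurableSet_Ioc).aestronglyMeasurable)
    (fun i => Eventually.of_forall fun u => ?_)
    (Eventually.of_forall fun u => (hpt u).summable) ?_ (Eventually.of_forall hpt)
  · exact (Real.norm_of_nonneg (Set.indicator_nonneg (fun x _ => h0 x) u)).le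
  · simp_rw [fun u => (hpt u).tsum_eq]
    refine hi.bdd_mul (c := |b - a| + 1) ?_ (Eventually.of_forall fun u => ?_)
    · exact Measurable.aestronglyMeasurable (by fun_prop)
    · have h1 := Int.fract_nonneg (b - ω * u)
      have h2 := Int.fract_lt_one (b - ω * u)
      have h3 := Int.fract_nonneg (a - ω * u)
      have h4 := Int.fract_lt_one (a - ω * u)
      rw [Real.norm_eq_abs, abs_le, abs_of_nonneg (sub_nonneg.2 hab)]
      constructor <;> linarith

lemma integrable_fract_mul {f : ℝ → ℝ} (hi : Integrable f) (a ω : ℝ) :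
    Integrable fun u => Int.fract (a - ω * u) * f u := by
  refine hi.bdd_mul (c := 1) (Measurable.aestronglyMeasurable (by fun_prop))
    (Eventually.of_forall fun u => ?_)
  rw [Real.norm_of_nonneg (Int.fract_nonneg _)]
  exact (Int.fract_lt_one _).le

lemma abs_integral_fract_sub_le {f : ℝ → ℝ} (hi : Integrable f) {a b ω : ℝ} (hω : 0 < ω) :
    |(∫ u, ((b - a) - (Int.fract (b - ω * u) - Int.fract (a - ω * u))) * f u)
      - (b - a) * ∫ u, f u| ≤ ∫ u, |f (u + (b - a) / ω) - f u| := by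
  have his : Integrable (fun u => f (u + (b - a) / ω)) := hi.comp_add_right _
  have hshift : ∫ u, Int.fract (b - ω * u) * f u =
      ∫ u, Int.fract (a - ω * u) * f (u + (b - a) / ω) := by
    rw [← integral_add_right_eq_self _ ((b - a) / ω)]
    congr 1
    ext u
    congr 2
    field_simp
    ring
  have hexp : ∫ u, ((b - a) - (Int.fract (b - ω * u) - Int.fract (a - ω * u))) * f u =
      (b - a) * (∫ u, f u) - ((∫ u, Int.fract (b - ω * u) * f u)
        - ∫ u, Int.fract (a - ω * u) * f u) := by
    have hd : Integrable fun u => Int.fract (b - ω * u) * f u - Int.fract (a - ω * u) * f u :=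
      (integrable_fract_mul hi b ω).sub (integrable_fract_mul hi a ω)
    rw [← integral_const_mul,
      ← integral_sub (integrable_fract_mul hi b ω) (integrable_fract_mul hi a ω),
      ← integral_sub (hi.const_mul (b - a)) hd]
    congr 1
    ext u
    ring
  rw [hexp, hshift, ← integral_sub (integrable_fract_mul his a ω) (integrable_fract_mul hi a ω)]
  rw [sub_sub_cancel_left, abs_neg]
  refine (abs_integral_le_integral_abs).trans (integral_mono
    ((integrable_fract_mul his a ω).sub (integrable_fract_mul hi a ω)).abs (his.sub hi).abs ?_)
  intro u
  change |_| ≤ |_|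
  rw [← mul_sub, abs_mul, abs_of_nonneg (Int.fract_nonneg _)]
  exact mul_le_of_le_one_left (abs_nonneg _) (Int.fract_lt_one _).le

/-- The law of rare events for infinite products `∏ (1 + w pᵢ)`. -/
lemma tendsto_tprod_one_add_mul {ι α : Type*} {l : Filter α} {p : α → ι → ℝ} {S C : α → ℝ} {s : ℝ}
    (w : ℂ) (hp0 : ∀ᶠ x in l, ∀ i, 0 ≤ p x i) (hpC : ∀ᶠ x in l, ∀ i, p x i ≤ C x)
    (hpS : ∀ᶠ x in l, HasSum (p x) (S x)) (hC : Tendsto C l (nhds 0))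
    (hS : Tendsto S l (nhds s)) :
    Tendsto (fun x => ∏' i, (1 + w * (p x i : ℂ))) l (nhds (Complex.exp (w * s))) := by
  have hsmall : ∀ᶠ x in l, ‖w‖ * C x < 1 / 2 := by
    have := hC.const_mul ‖w‖
    rw [mul_zero] at this
    exact this.eventually (gt_mem_nhds (by norm_num))
  have hmain : ∀ᶠ x in l,
      (∏' i, (1 + w * (p x i : ℂ))) =
        Complex.exp (∑' i, Complex.log (1 + w * (p x i : ℂ))) ∧
      ‖(∑' i, Complex.log (1 + w * (p x i : ℂ))) - w * S x‖ ≤ ‖w‖ ^ 2 * C x * S x := by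
    filter_upwards [hp0, hpC, hpS, hsmall] with x h0 h1 h2 h3
    have hnorm : ∀ i, ‖w * (p x i : ℂ)‖ = ‖w‖ * p x i := by
      intro i
      rw [norm_mul, Complex.norm_real, Real.norm_of_nonneg (h0 i)]
    have hlt : ∀ i, ‖w * (p x i : ℂ)‖ < 1 / 2 := by
      intro i
      rw [hnorm]
      exact (mul_le_mul_of_nonneg_left (h1 i) (norm_nonneg w)).trans_lt h3
    have hsumC : HasSum (fun i => w * (p x i : ℂ)) (w * S x) :=
      (Complex.hasSum_ofReal.2 h2).mul_left w
    have hlog := Complex.summable_log_one_add_of_summable hsumC.summable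
    refine ⟨(Complex.cexp_tsum_eq_tprod (fun i hi => ?_) hlog).symm, ?_⟩
    · have : w * (p x i : ℂ) = -1 := by linear_combination hi
      have h := hlt i
      rw [this] at h
      norm_num at h
    · have hd := hlog.hasSum.sub hsumC
      rw [← hd.tsum_eq]
      refine tsum_of_norm_bounded (h2.mul_left (‖w‖ ^ 2 * C x)) fun i => ?_
      refine (Complex.norm_log_one_add_sub_self_le ((hlt i).trans (by norm_num))).trans ?_
      have hinv : (1 - ‖w * (p x i : ℂ)‖)⁻¹ ≤ 2 := by
        rw [inv_le_comm₀ (by linarith [hlt i]) (by norm_num)]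
        linarith [hlt i]
      calc ‖w * (p x i : ℂ)‖ ^ 2 * (1 - ‖w * (p x i : ℂ)‖)⁻¹ / 2
          ≤ ‖w * (p x i : ℂ)‖ ^ 2 * 2 / 2 := by gcongr
        _ = ‖w‖ ^ 2 * p x i * p x i := by rw [hnorm]; ring
        _ ≤ ‖w‖ ^ 2 * C x * p x i := by
          have := h0 i
          have := h1 i
          gcongr
  have hbound : Tendsto (fun x => ‖w‖ ^ 2 * C x * S x) l (nhds 0) := by
    simpa using (hC.const_mul (‖w‖ ^ 2)).mul hS
  have hdiff := squeeze_zero_norm' (hmain.mono fun x h => h.2) hbound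
  have hSC : Tendsto (fun x => w * (S x : ℂ)) l (nhds (w * s)) :=
    ((Complex.continuous_ofReal.tendsto s).comp hS).const_mul w
  have hlogs := hdiff.add hSC
  simp only [sub_add_cancel, zero_add] at hlogs
  exact ((Complex.continuous_exp.tendsto _).comp hlogs).congr'
    (hmain.mono fun x h => h.1.symm)



/-- Fix `γ ∈ (0,1]`. For every `t ∈ ℝ`, `T > 0` and complex `z` with
`|z| ≤ 1`, the generating function `q_γ^{(σ)}(z) = Π_{i∈ℤ} (1 + (z-1)·γ·p_i(t,t+T))` of
the number of arrivals in `(t,t+T]` of the PSRA process with independent deletions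
(each arrival kept with probability `γ`) converges, as `σ → ∞`, to `exp(γλT(z-1))`,
the generating function of the Poisson distribution with intensity `γλT`. -/
theorem psra_deleted_generating_function_tendsto_poisson (γ lam M : ℝ)
    (hγ0 : 0 < γ) (hγ1 : γ ≤ 1) (hlam : 0 < lam)
    (f : ℝ → ℝ) (hf_cont : Continuous f) (hf_nonneg : ∀ x, 0 ≤ f x)
    (hf_int : Integrable f) (hf_prob : ∫ x, f x = 1)
    (hf_bdd : ∀ x, f x ≤ M)
    (hf_var : Integrable (fun x => x ^ 2 * f x))
    (t T : ℝ) (hT : 0 < T) (z : ℂ) (hz : ‖z‖ ≤ 1)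
    (p : ℝ → ℤ → ℝ)
    (hp : ∀ σ i, p σ i = ∫ x in t..(t + T), (1 / σ) * f ((x - i / lam) / σ)) :
    Tendsto (fun σ : ℝ => ∏' i : ℤ, (1 + (z - 1) * (γ : ℂ) * (p σ i : ℂ)))
      atTop (nhds (Complex.exp ((γ * lam * T : ℝ) * (z - 1)))) := by
  have hpu : ∀ σ : ℝ, 0 < σ → ∀ i : ℤ, p σ i =
      ∫ u in (lam * t - i) / (lam * σ)..(lam * (t + T) - i) / (lam * σ), f u := by
    intro σ hσ i
    rw [hp, intervalIntegral.integral_const_mul]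
    simp_rw [sub_div _ _ σ]
    rw [intervalIntegral.integral_comp_div_sub _ hσ.ne', smul_eq_mul, ← mul_assoc,
      one_div_mul_cancel hσ.ne', one_mul]
    congr 1 <;> field_simp
  have hw : Complex.exp ((γ * lam * T : ℝ) * (z - 1)) =
      Complex.exp ((z - 1) * (γ : ℂ) * ((lam * T : ℝ) : ℂ)) := by
    congr 1
    push_cast
    ring
  rw [hw]
  refine tendsto_tprod_one_add_mul (C := fun σ => M * T / σ)
    (S := fun σ => ∫ u, ((lam * (t + T) - lam * t) - (Int.fract (lam * (t + T) - lam * σ * u)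
      - Int.fract (lam * t - lam * σ * u))) * f u) _ ?_ ?_ ?_ ?_ ?_
  · filter_upwards [eventually_gt_atTop 0] with σ hσ i
    rw [hp]
    exact intervalIntegral.integral_nonneg (by linarith)
      fun x _ => mul_nonneg (by positivity) (hf_nonneg _)
  · filter_upwards [eventually_gt_atTop 0] with σ hσ i
    have h := intervalIntegral.norm_integral_le_of_norm_le_const (a := t) (b := t + T)
      (f := fun x => (1 / σ) * f ((x - i / lam) / σ)) (C := 1 / σ * M) (fun x _ => by
        rw [Real.norm_of_nonneg (mul_nonneg (by positivity) (hf_nonneg _))]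
        exact mul_le_mul_of_nonneg_left (hf_bdd _) (by positivity))
    rw [← hp, add_sub_cancel_left, abs_of_pos hT] at h
    calc p σ i ≤ ‖p σ i‖ := Real.le_norm_self _
      _ ≤ 1 / σ * M * T := h
      _ = M * T / σ := by ring
  · filter_upwards [eventually_gt_atTop 0] with σ hσ
    rw [funext (hpu σ hσ)]
    exact hasSum_integral_windows hf_nonneg hf_int (by gcongr; linarith) (by positivity)
  · exact tendsto_const_nhds.div_atTop tendsto_id
  · have hshift : Tendsto (fun σ : ℝ => (lam * (t + T) - lam * t) / (lam * σ)) atTop (nhds 0) :=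
      tendsto_const_nhds.div_atTop (tendsto_id.const_mul_atTop hlam)
    have hb := (tendsto_integral_abs_translate_sub hf_cont hf_nonneg hf_int).comp hshift
    rw [tendsto_iff_norm_sub_tendsto_zero]
    refine squeeze_zero' (Eventually.of_forall fun _ => norm_nonneg _) ?_ hb
    filter_upwards [eventually_gt_atTop 0] with σ hσ
    have h := abs_integral_fract_sub_le hf_int (a := lam * t) (b := lam * (t + T))
      (mul_pos hlam hσ)
    rw [hf_prob, mul_one] at h
    rw [Real.norm_eq_abs, show lam * T = lam * (t + T) - lam * t by ring]
    exact h
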